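/- Let 1 ≤ p ≤ ∞, a = 1/(2·max{2,p}), and ε > 0. Then there exists an entire function f and a constant C > 0 such that M_p(f,r) ≤ C·e^r/r^{a-ε} for all r > 0, and there exist sets A, B ⊆ ℕ of upper density 1 with sup_{|z|≤m}|f^{(n)}(z)| → 0 along A and sup_{|z|≤m}|f^{(n)}(z)| → ∞ along B, for every m ∈ ℕ. -/

import Mathlib

open Filter Metric

open scoped Classical in
/-- The upper density of a set of natural numbers. -/
noncomputable def upperDensity (A : Set ℕ) : ℝ :=
  Filter.limsup (fun N : ℕ => (((Finset.Icc 1 N).filter (· ∈ A)).card : ℝ) / N) Filter.atTop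

/-- The sup of `‖f‖` over the closed ball of radius `m` centered at `0`. -/
noncomputable def supD (f : ℂ → ℂ) (m : ℝ) : ℝ :=
  sSup ((fun z => ‖f z‖) '' Metric.closedBall (0:ℂ) m)

/-- The integral p-mean of `f` on the circle of radius `r` (sup for `p = ∞`). -/
noncomputable def Mp (p : ENNReal) (f : ℂ → ℂ) (r : ℝ) : ℝ :=
  if p = ⊤ then sSup ((fun z => ‖f z‖) '' Metric.sphere (0:ℂ) r)
  else ((1 / (2 * Real.pi)) *
      ∫ t in (0:ℝ)..(2 * Real.pi), ‖f (r * Complex.exp (t * Complex.I))‖ ^ p.toReal)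
    ^ (1 / p.toReal)

open Nat in
lemma summ_basic (x : ℝ) : Summable (fun n : ℕ => ((n:ℝ)+1)^2 * |x|^n / n !) := by
  have h := Real.summable_pow_div_factorial (4*|x|)
  refine Summable.of_nonneg_of_le (fun n => by positivity) (fun n => ?_) h
  have h2 : ((n:ℝ)+1) ≤ 2^n := by
    exact_mod_cast Nat.lt_two_pow_self
  have h3 : ((n:ℝ)+1)^2 ≤ 4^n := by
    calc ((n:ℝ)+1)^2 ≤ (2^n)^2 := by gcongr
      _ = 4^n := by rw [← pow_mul, mul_comm, pow_mul]; norm_num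
  rw [mul_pow]
  gcongr

open Nat in
lemma summ_one (x : ℝ) : Summable (fun n : ℕ => ((n:ℝ)+1) * |x|^n / n !) := by
  refine Summable.of_nonneg_of_le (fun n => by positivity) (fun n => ?_) (summ_basic x)
  gcongr
  nlinarith [(n.cast_nonneg : (0:ℝ) ≤ n)]

open Nat in
noncomputable def FF (c : ℕ → ℝ) (z : ℂ) : ℂ := ∑' n : ℕ, (c n : ℂ) * z^n / (n !)

open Nat in
lemma FF_summable {c : ℕ → ℝ} {M : ℝ} (hc : ∀ n, |c n| ≤ M * (n+1)) (r : ℝ) :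
    Summable (fun n : ℕ => |c n| * |r|^n / n !) := by
  refine Summable.of_nonneg_of_le (fun n => by positivity) (fun n => ?_) ((summ_one r).mul_left M)
  have := hc n
  calc |c n| * |r|^n / n ! ≤ M * (n+1) * |r|^n / n ! := by gcongr
    _ = _ := by ring

open Nat in
lemma FF_norm_term (c : ℕ → ℝ) (z : ℂ) (n : ℕ) :
    ‖(c n : ℂ) * z^n / (n !)‖ = |c n| * ‖z‖^n / n ! := by
  simp

open Nat in
lemma FF_deriv {c : ℕ → ℝ} {M : ℝ} (hc : ∀ n, |c n| ≤ M * (n+1)) (z : ℂ) :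
    HasDerivAt (FF c) (FF (fun n => c (n+1)) z) z := by
  have hM : 0 ≤ M := by
    have := hc 0
    simp at this
    exact (abs_nonneg _).trans this
  have hc' : ∀ n, |c (n+1)| ≤ (2*M) * (n+1) := fun n => by
    have := hc (n+1)
    push_cast at this
    nlinarith [mul_nonneg hM (n.cast_nonneg : (0:ℝ) ≤ n)]
  set R := ‖z‖ + 1 with hR
  have hR0 : 0 ≤ R := by positivity
  have hsplit : FF c = fun w => (c 0 : ℂ) + ∑' n : ℕ, (c (n+1) : ℂ) * w^(n+1) / (n+1)! := by
    funext w
    unfold FF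
    have hs : Summable (fun n : ℕ => (c n : ℂ) * w^n / n !) := by
      apply Summable.of_norm
      simp only [FF_norm_term]
      simpa using FF_summable hc ‖w‖
    rw [hs.tsum_eq_zero_add]
    simp
  rw [hsplit]
  refine HasDerivAt.const_add _ ?_
  have hu := FF_summable hc' R
  rw [abs_of_nonneg hR0] at hu
  refine hasDerivAt_tsum_of_isPreconnected (t := Metric.ball 0 R) (y₀ := 0) (y := z)
    (g := fun n w => (c (n+1) : ℂ) * w^(n+1) / (n+1)!) (g' := fun n w => (c (n+1) : ℂ) * w^n / n !)
    hu Metric.isOpen_ball (convex_ball _ _).isPreconnected ?_ ?_ ?_ ?_ ?_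
  · intro n y hy
    have h := ((hasDerivAt_pow (n+1) y).const_mul (c (n+1) : ℂ)).div_const ((n+1)! : ℂ)
    refine h.congr_deriv ?_
    rw [Nat.factorial_succ]
    have : (n ! : ℂ) ≠ 0 := by exact_mod_cast Nat.factorial_ne_zero n
    have h2 : (n + 1 : ℂ) ≠ 0 := by exact_mod_cast Nat.succ_ne_zero n
    push_cast
    field_simp
  · intro n y hy
    rw [FF_norm_term (fun n => c (n+1))]
    have : ‖y‖ ≤ R := by simpa using (Metric.mem_ball.1 hy).le
    gcongr
  · simp [R]; positivity
  · simp
  · simp [R]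

lemma shift_bound {c : ℕ → ℝ} {M : ℝ} (hc : ∀ n, |c n| ≤ M * (n+1)) (k : ℕ) :
    ∀ n, |c (n+k)| ≤ (M * (k+1)) * (n+1) := fun n => by
  have hM : 0 ≤ M := by
    have := hc 0
    simp at this
    exact (abs_nonneg _).trans this
  refine (hc _).trans ?_
  push_cast
  rw [mul_assoc]
  gcongr
  nlinarith [(n.cast_nonneg : (0:ℝ) ≤ n), (k.cast_nonneg : (0:ℝ) ≤ k), mul_nonneg (n.cast_nonneg : (0:ℝ) ≤ n) (k.cast_nonneg : (0:ℝ) ≤ k)]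

lemma FF_iter {c : ℕ → ℝ} {M : ℝ} (hc : ∀ n, |c n| ≤ M * (n+1)) (k : ℕ) :
    iteratedDeriv k (FF c) = FF (fun n => c (n+k)) := by
  induction k with
  | zero => simp
  | succ k ih =>
    rw [iteratedDeriv_succ, ih]
    funext z
    rw [(FF_deriv (shift_bound hc k) z).deriv]
    congr 1
    funext n
    congr 1
    omega

open Nat in
lemma FF_norm_le {c : ℕ → ℝ} {M : ℝ} (hc : ∀ n, |c n| ≤ M * (n+1)) {z : ℂ} {r : ℝ} (hz : ‖z‖ ≤ r) :
    ‖FF c z‖ ≤ ∑' n : ℕ, |c n| * r^n / n ! := by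
  have hr : 0 ≤ r := (norm_nonneg _).trans hz
  have h := FF_summable hc r
  rw [abs_of_nonneg hr] at h
  unfold FF
  refine tsum_of_norm_bounded h.hasSum (fun n => ?_)
  rw [FF_norm_term]
  gcongr

lemma FF_differentiable {c : ℕ → ℝ} {M : ℝ} (hc : ∀ n, |c n| ≤ M * (n+1)) :
    Differentiable ℂ (FF c) := fun z => (FF_deriv hc z).differentiableAt

lemma FF_zero (c : ℕ → ℝ) : FF c 0 = c 0 := by
  unfold FF
  rw [tsum_eq_single 0]
  · simp
  · intro n hn; simp [hn]

open Nat in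
lemma poisson_max_aux {r : ℝ} (hr : 1 ≤ r) {n : ℕ} (hn : r ≤ 2 * n) :
    r^n / n ! ≤ Real.exp r / √r := by
  have hn0 : (0:ℝ) < n := by linarith
  have hs := Stirling.le_factorial_stirling n
  have hsq : √r ≤ √(2 * Real.pi * n) := by
    apply Real.sqrt_le_sqrt
    nlinarith [Real.pi_gt_three]
  have hsr : 0 < √r := Real.sqrt_pos.2 (by linarith)
  have key : r^n ≤ Real.exp r * (n / Real.exp 1)^n := by
    have h1 : r ≤ Real.exp (r/n) * (n / Real.exp 1) := by
      have := Real.add_one_le_exp (r/n - 1)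
      rw [Real.exp_sub] at this
      calc r = (r/n - 1 + 1) * n := by field_simp; ring
        _ ≤ (Real.exp (r/n) / Real.exp 1) * n := by gcongr
        _ = _ := by ring
    calc r^n ≤ (Real.exp (r/n) * (n / Real.exp 1))^n := by gcongr
      _ = _ := by
        rw [mul_pow, ← Real.exp_nat_mul]
        congr 2
        field_simp
  rw [div_le_div_iff₀ (by positivity) hsr]
  calc r^n * √r ≤ (Real.exp r * (n / Real.exp 1)^n) * √(2 * Real.pi * n) := by gcongr
    _ = Real.exp r * (√(2 * Real.pi * n) * (n / Real.exp 1)^n) := by ring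
    _ ≤ _ := by gcongr

open Nat in
lemma poisson_mono {r : ℝ} (hr : 0 ≤ r) {n m : ℕ} (hnm : n ≤ m) (hm : (m:ℝ) ≤ r) :
    r^n / n ! ≤ r^m / m ! := by
  induction m, hnm using Nat.le_induction with
  | base => exact le_rfl
  | succ m hnm ih =>
    push_cast at hm
    refine (ih (by linarith)).trans ?_
    rw [Nat.factorial_succ, pow_succ]
    push_cast
    rw [div_le_div_iff₀ (by positivity) (by positivity)]
    have : 0 ≤ r^m * (m ! : ℝ) := by positivity
    nlinarith

open Nat in
lemma poisson_max {r : ℝ} (hr : 1 ≤ r) (n : ℕ) : r^n / n ! ≤ Real.exp r / √r := by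
  have h1 : 1 ≤ ⌊r⌋₊ := by rwa [Nat.one_le_floor_iff]
  have h2 := Nat.lt_floor_add_one r
  have h3 := Nat.floor_le (show 0 ≤ r by linarith)
  have h1' : (1:ℝ) ≤ ⌊r⌋₊ := by exact_mod_cast h1
  rcases le_total n ⌊r⌋₊ with h | h
  · exact (poisson_mono (by linarith) h h3).trans (poisson_max_aux hr (by linarith))
  · have : (⌊r⌋₊ : ℝ) ≤ n := by exact_mod_cast h
    exact poisson_max_aux hr (by linarith)

open Nat in
lemma hasSum_one (r : ℝ) : HasSum (fun n : ℕ => ((n:ℝ)+1) * r^n / n !) ((r+1) * Real.exp r) := by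
  have h0 : HasSum (fun n : ℕ => r^n / n !) (Real.exp r) := by
    rw [Real.exp_eq_exp_ℝ]; exact NormedSpace.expSeries_div_hasSum_exp r
  have h1 : HasSum (fun n : ℕ => (n:ℝ) * r^n / n !) (r * Real.exp r) := by
    rw [hasSum_nat_add_iff' 1 |>.symm]
    simp only [Finset.range_one, Finset.sum_singleton, Nat.cast_zero, zero_mul, zero_div, sub_zero]
    have e : (fun n : ℕ => (((n+1 : ℕ):ℝ)) * r^(n+1) / (n+1)!) = fun n : ℕ => r * (r^n / n !) := by
      funext n
      rw [Nat.factorial_succ, pow_succ]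
      push_cast
      field_simp
    rw [e]
    exact h0.mul_left r
  have e : (fun n : ℕ => ((n:ℝ)+1) * r^n / n !) = fun n : ℕ => (n:ℝ) * r^n / n ! + r^n / n ! := by
    funext n; ring
  rw [e, add_mul, one_mul]
  exact h1.add h0

open Nat in
/-- weighted Poisson sum -/
lemma poisson_weight {r η : ℝ} (hr : 1 ≤ r) (h0 : 0 ≤ η) (h1 : η ≤ 1) {d : ℕ → ℝ}
    (hd0 : ∀ n, 0 ≤ d n) (hd : ∀ n : ℕ, d n ≤ ((n:ℝ)+1)^η) :
    Summable (fun n : ℕ => d n * r^n / n !) ∧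
    ∑' n : ℕ, d n * r^n / n ! ≤ 4 * r^η * Real.exp r := by
  have hr0 : 0 < r := by linarith
  have hA : HasSum (fun n : ℕ => (r+1)^η * (r^n / n ! + (r+1)⁻¹ * (((n:ℝ)+1) * r^n / n !)))
      ((r+1)^η * (Real.exp r + (r+1)⁻¹ * ((r+1) * Real.exp r))) := by
    refine HasSum.mul_left _ (HasSum.add ?_ ((hasSum_one r).mul_left _))
    rw [Real.exp_eq_exp_ℝ]; exact NormedSpace.expSeries_div_hasSum_exp r
  have hle : ∀ n : ℕ, d n * r^n / n ! ≤
      (r+1)^η * (r^n / n ! + (r+1)⁻¹ * (((n:ℝ)+1) * r^n / n !)) := fun n => by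
    have hx : ((n:ℝ)+1)^η ≤ (r+1)^η * (1 + ((n:ℝ)+1)/(r+1)) := by
      set x := ((n:ℝ)+1)/(r+1) with hx
      have hx0 : 0 ≤ x := by positivity
      have : ((n:ℝ)+1) = (r+1) * x := by rw [hx]; field_simp
      rw [this, Real.mul_rpow (by positivity) hx0]
      gcongr
      rcases le_total x 1 with h | h
      · exact (Real.rpow_le_one hx0 h h0).trans (by linarith)
      · calc x^η ≤ x^(1:ℝ) := Real.rpow_le_rpow_of_exponent_le h h1
          _ ≤ 1 + x := by rw [Real.rpow_one]; linarith
    calc d n * r^n / n ! ≤ ((r+1)^η * (1 + ((n:ℝ)+1)/(r+1))) * r^n / n ! := by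
          gcongr; exact (hd n).trans hx
      _ = _ := by ring
  have hs : Summable (fun n : ℕ => d n * r^n / n !) :=
    Summable.of_nonneg_of_le (fun n => by have := hd0 n; positivity) hle hA.summable
  refine ⟨hs, ?_⟩
  refine (hs.tsum_le_tsum hle hA.summable).trans ?_
  rw [hA.tsum_eq, ← mul_assoc, inv_mul_cancel₀ (by positivity), one_mul]
  have : (r+1)^η ≤ 2 * r^η := by
    calc (r+1)^η ≤ (2*r)^η := by gcongr; linarith
      _ = 2^η * r^η := Real.mul_rpow (by norm_num) hr0.le
      _ ≤ 2^(1:ℝ) * r^η := by gcongr; norm_num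
      _ = _ := by rw [Real.rpow_one]
  nlinarith [Real.exp_pos r]

lemma int_exp (k : ℤ) : ∫ t in (0:ℝ)..(2 * Real.pi), Complex.exp (((k:ℂ) * Complex.I) * t) =
    if k = 0 then (2 * Real.pi : ℂ) else 0 := by
  split_ifs with h
  · simp [h]
  · rw [integral_exp_mul_complex (by simp [h])]
    have : Complex.exp ((k:ℂ) * Complex.I * ((2 * Real.pi : ℝ) : ℂ)) = 1 := by
      rw [← Complex.exp_int_mul_two_pi_mul_I k]
      congr 1; push_cast; ring
    rw [this]; simp

lemma parseval {a : ℕ → ℝ} (ha : Summable (fun n => |a n|)) {g : ℝ → ℂ} (hgc : Continuous g)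
    (hg : ∀ t : ℝ, HasSum (fun n : ℕ => (a n : ℂ) * Complex.exp (((n:ℂ) * Complex.I) * t)) (g t)) :
    ∫ t in (0:ℝ)..(2 * Real.pi), ‖g t‖^2 = 2 * Real.pi * ∑' n, (a n)^2 := by
  have hnorm : ∀ (n : ℕ) (t : ℝ), ‖Complex.exp (((n:ℂ) * Complex.I) * t)‖ = 1 := fun n t => by
    rw [show ((n:ℂ) * Complex.I) * t = ((n * t : ℝ) : ℂ) * Complex.I by push_cast; ring,
      Complex.norm_exp_ofReal_mul_I]
  have hgb : ∀ t, ‖g t‖ ≤ ∑' n, |a n| := fun t => by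
    rw [← (hg t).tsum_eq]
    refine tsum_of_norm_bounded ha.hasSum (fun n => ?_)
    rw [norm_mul, hnorm]; simp
  have hconj : ∀ t : ℝ, HasSum (fun n : ℕ => (a n : ℂ) * Complex.exp (-((n:ℂ) * Complex.I) * t))
      (starRingEnd ℂ (g t)) := fun t => by
    have := (hg t).map (starRingEnd ℂ) Complex.continuous_conj
    refine this.congr_fun ?_ |> id
    intro n
    simp [← Complex.exp_conj]
  have hin : ∀ n : ℕ, ∫ t in (0:ℝ)..(2 * Real.pi),
      Complex.exp (((n:ℂ) * Complex.I) * t) * starRingEnd ℂ (g t) = 2 * Real.pi * a n := by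
    intro n
    have hs : HasSum (fun m : ℕ => ∫ t in (0:ℝ)..(2 * Real.pi),
        Complex.exp (((n:ℂ) * Complex.I) * t) * ((a m : ℂ) * Complex.exp (-((m:ℂ) * Complex.I) * t)))
        (∫ t in (0:ℝ)..(2 * Real.pi),
          Complex.exp (((n:ℂ) * Complex.I) * t) * starRingEnd ℂ (g t)) := by
      refine intervalIntegral.hasSum_integral_of_dominated_convergence (fun m _ => |a m|) ?_ ?_ ?_ ?_ ?_
      · intro m
        exact Continuous.aestronglyMeasurable (by fun_prop)
      · intro m
        refine Eventually.of_forall fun t _ => ?_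
        have := hnorm m t
        rw [norm_mul, hnorm, norm_mul, neg_mul, Complex.exp_neg, norm_inv, hnorm]
        simp
      · exact Eventually.of_forall fun t _ => ha
      · exact intervalIntegrable_const
      · exact Eventually.of_forall fun t _ => (hconj t).mul_left _
    rw [← hs.tsum_eq, tsum_eq_single n]
    · have := int_exp 0
      simp at this
      rw [intervalIntegral.integral_congr (g := fun _ => (a n : ℂ))]
      · simp
      · intro t _
        simp only
        rw [mul_left_comm, ← Complex.exp_add]
        simp
    · intro m hm
      have := int_exp ((n:ℤ) - m)
      rw [if_neg (by omega)] at this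
      rw [intervalIntegral.integral_congr (g := fun t : ℝ => (a m : ℂ) * Complex.exp ((((n:ℤ) - m : ℤ):ℂ) * Complex.I * t))]
      · rw [intervalIntegral.integral_const_mul, this, mul_zero]
      · intro t _
        simp only
        rw [mul_left_comm, ← Complex.exp_add]
        congr 2
        push_cast; ring
  have hout : HasSum (fun n : ℕ => ∫ t in (0:ℝ)..(2 * Real.pi),
        (a n : ℂ) * Complex.exp (((n:ℂ) * Complex.I) * t) * starRingEnd ℂ (g t))
        (∫ t in (0:ℝ)..(2 * Real.pi), g t * starRingEnd ℂ (g t)) := by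
    refine intervalIntegral.hasSum_integral_of_dominated_convergence
      (fun m _ => |a m| * ∑' n, |a n|) ?_ ?_ ?_ ?_ ?_
    · intro m
      exact Continuous.aestronglyMeasurable (by
        have := Complex.continuous_conj.comp hgc
        fun_prop)
    · intro m
      refine Eventually.of_forall fun t _ => ?_
      rw [norm_mul, norm_mul, hnorm, RCLike.norm_conj]
      have := hgb t
      simp only [Complex.norm_real, Real.norm_eq_abs, mul_one]
      gcongr
    · exact Eventually.of_forall fun t _ => ha.mul_right _
    · exact intervalIntegrable_const
    · exact Eventually.of_forall fun t _ => (hg t).mul_right _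
  have h2 : ∀ n : ℕ, ∫ t in (0:ℝ)..(2 * Real.pi),
        (a n : ℂ) * Complex.exp (((n:ℂ) * Complex.I) * t) * starRingEnd ℂ (g t)
        = ((2 * Real.pi * (a n)^2 : ℝ) : ℂ) := by
    intro n
    simp_rw [mul_assoc (a n : ℂ)]
    rw [intervalIntegral.integral_const_mul, hin n]
    push_cast; ring
  simp_rw [h2, Complex.mul_conj, Complex.normSq_eq_norm_sq] at hout
  rw [intervalIntegral.integral_ofReal] at hout
  have := (Complex.hasSum_ofReal.1 hout).tsum_eq
  rw [← this, tsum_mul_left]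

open Nat in
lemma FF_L2 {c : ℕ → ℝ} {M : ℝ} (hc : ∀ n, |c n| ≤ M * (n+1)) (r : ℝ) :
    ∫ t in (0:ℝ)..(2 * Real.pi), ‖FF c (r * Complex.exp (t * Complex.I))‖^2
      = 2 * Real.pi * ∑' n : ℕ, (c n * r^n / n !)^2 := by
  have hs := FF_summable hc r
  refine parseval (a := fun n => c n * r^n / n !) ?_ ?_ ?_
  · refine hs.congr fun n => ?_
    rw [abs_div, abs_mul, abs_pow]; simp
  · exact (FF_differentiable hc).continuous.comp (by fun_prop)
  · intro t
    have h1 : Summable (fun n : ℕ => (c n : ℂ) * ((r:ℂ) * Complex.exp (t * Complex.I))^n / n !) := by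
      apply Summable.of_norm
      simp only [FF_norm_term]
      refine hs.congr fun n => ?_
      simp [Complex.norm_exp_ofReal_mul_I]
    refine h1.hasSum.congr_fun ?_ |> id
    intro n
    rw [mul_pow, ← Complex.exp_nat_mul]
    push_cast
    rw [show (n:ℂ) * (t * Complex.I) = n * Complex.I * t by ring]
    ring

lemma supD_le {f : ℂ → ℂ} {m : ℝ} (hm : 0 ≤ m) {K : ℝ} (h : ∀ z, ‖z‖ ≤ m → ‖f z‖ ≤ K) : supD f m ≤ K := by
  unfold supD
  refine csSup_le ⟨_, 0, by simpa using hm, rfl⟩ ?_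
  rintro _ ⟨z, hz, rfl⟩
  exact h z (by simpa using hz)

lemma supD_ge {f : ℂ → ℂ} (hf : Continuous f) {m : ℝ} (hm : 0 ≤ m) : ‖f 0‖ ≤ supD f m := by
  unfold supD
  refine le_csSup ?_ ⟨0, by simpa using hm, rfl⟩
  exact ((isCompact_closedBall (0:ℂ) m).image (by fun_prop)).bddAbove

lemma upperDensity_one {A : Set ℕ} (u v : ℕ → ℕ) (hu : ∀ j, 0 < u j)
    (hv : ∀ j, v j = (j+1) * u j)
    (hA : ∀ j, ∀ n, u j < n → n ≤ v j → n ∈ A) (huA : ∀ j, j ≤ u j) : upperDensity A = 1 := by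
  classical
  unfold upperDensity
  have hle : ∀ N : ℕ, (((Finset.Icc 1 N).filter (· ∈ A)).card : ℝ) / N ≤ 1 := fun N => by
    apply div_le_one_of_le₀ _ (Nat.cast_nonneg _)
    have := Finset.card_filter_le (Finset.Icc 1 N) (· ∈ A)
    rw [Nat.card_Icc] at this
    exact_mod_cast this
  have hnn : ∀ N : ℕ, 0 ≤ (((Finset.Icc 1 N).filter (· ∈ A)).card : ℝ) / N := fun N => by positivity
  have hge : ∀ j : ℕ, 1 - 1 / ((j:ℝ)+1) ≤ (((Finset.Icc 1 (v j)).filter (· ∈ A)).card : ℝ) / (v j) := fun j => by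
    have hsub : Finset.Ioc (u j) (v j) ⊆ (Finset.Icc 1 (v j)).filter (· ∈ A) := by
      intro n hn
      rw [Finset.mem_Ioc] at hn
      simp only [Finset.mem_filter, Finset.mem_Icc]
      exact ⟨⟨by omega, hn.2⟩, hA j n hn.1 hn.2⟩
    have hc := Finset.card_le_card hsub
    rw [Nat.card_Ioc] at hc
    have hc2 : v j ≤ ((Finset.Icc 1 (v j)).filter (· ∈ A)).card + u j := by omega
    have hc3 : (v j : ℝ) ≤ (((Finset.Icc 1 (v j)).filter (· ∈ A)).card : ℝ) + u j := by exact_mod_cast hc2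
    have hu0 : (0:ℝ) < u j := by exact_mod_cast hu j
    have hvr : (v j : ℝ) = (j+1) * u j := by exact_mod_cast hv j
    have hv0 : (0:ℝ) < v j := by rw [hvr]; positivity
    rw [le_div_iff₀ hv0]
    have : (1 - 1 / ((j:ℝ)+1)) * v j = v j - u j := by rw [hvr]; field_simp
    rw [this]; linarith
  apply le_antisymm
  · refine limsup_le_of_le ?_ (Eventually.of_forall fun N => ?_)
    · exact IsCoboundedUnder.of_frequently_ge (a := 0) (Frequently.of_forall fun N => by convert hnn N)
    · convert hle N
  · refine le_of_forall_lt fun x hx => ?_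
    obtain ⟨y, hxy, hy⟩ := exists_between hx
    refine hxy.trans_le (le_limsup_of_frequently_le ?_ ?_)
    · rw [frequently_atTop]
      intro N
      have ht : Tendsto (fun j : ℕ => 1 - 1 / ((j:ℝ)+1)) atTop (nhds (1 - 0)) :=
        tendsto_const_nhds.sub tendsto_one_div_add_atTop_nhds_zero_nat
      rw [sub_zero] at ht
      obtain ⟨j, hj1, hj2⟩ := ((ht.eventually (eventually_ge_nhds hy)).and (eventually_ge_atTop N)).exists
      refine ⟨v j, ?_, hj1.trans ?_⟩
      · have := huA j
        rw [hv]; nlinarith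
      · convert hge j
    · exact isBoundedUnder_of ⟨1, fun N => by convert hle N⟩

lemma Mp_le_sup {p : ENNReal} (hp : 1 ≤ p) {f : ℂ → ℂ} (hf : Continuous f) {r S : ℝ} (hr : 0 ≤ r)
    (h : ∀ z : ℂ, ‖z‖ = r → ‖f z‖ ≤ S) : Mp p f r ≤ S := by
  have hS : 0 ≤ S := (norm_nonneg _).trans (h r (by simp [abs_of_nonneg hr]))
  unfold Mp
  split_ifs with hT
  · refine csSup_le ⟨_, (r:ℂ), by simp [abs_of_nonneg hr], rfl⟩ ?_
    rintro _ ⟨z, hz, rfl⟩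
    exact h z (by simpa using hz)
  · have hq : 1 ≤ p.toReal := by
      have := ENNReal.toReal_mono hT hp
      simpa using this
    set q := p.toReal with hqdef
    have hpi := Real.pi_pos
    have hle : ∫ t in (0:ℝ)..(2 * Real.pi), ‖f (r * Complex.exp (t * Complex.I))‖ ^ q
        ≤ ∫ t in (0:ℝ)..(2 * Real.pi), S ^ q := by
      refine intervalIntegral.integral_mono_on (by positivity) ?_ intervalIntegrable_const ?_
      · refine Continuous.intervalIntegrable ?_ _ _
        refine Continuous.rpow_const ?_ (fun _ => Or.inr (by linarith))
        fun_prop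
      · intro t _
        refine Real.rpow_le_rpow (norm_nonneg _) (h _ ?_) (by linarith)
        simp [Complex.norm_exp_ofReal_mul_I, abs_of_nonneg hr]
    rw [intervalIntegral.integral_const, sub_zero, smul_eq_mul] at hle
    have h0 : 0 ≤ ∫ t in (0:ℝ)..(2 * Real.pi), ‖f (r * Complex.exp (t * Complex.I))‖ ^ q :=
      intervalIntegral.integral_nonneg (by positivity) (fun t _ => by positivity)
    calc _ ≤ ((1 / (2 * Real.pi)) * (2 * Real.pi * S ^ q)) ^ (1/q) := by gcongr
      _ = (S^q)^(1/q) := by congr 1; field_simp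
      _ = S := by rw [one_div, Real.rpow_rpow_inv hS (by linarith)]

lemma Mp_fin {p : ENNReal} (hp : 1 ≤ p) (hT : p ≠ ⊤) {f : ℂ → ℂ} (hf : Continuous f) {r X : ℝ}
    (hr : 1 ≤ r) (hX : 0 < X) (h : ∀ z : ℂ, ‖z‖ = r → ‖f z‖ ≤ X)
    (h2 : ∫ t in (0:ℝ)..(2 * Real.pi), ‖f (r * Complex.exp (t * Complex.I))‖ ^ 2
      ≤ 2 * Real.pi * (X^2 * r^(-(1/2) : ℝ))) :
    Mp p f r ≤ 2 * X * r ^ (-(1 / (2 * max 2 p.toReal))) := by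
  have hq : 1 ≤ p.toReal := by
    have := ENNReal.toReal_mono hT hp
    simpa using this
  unfold Mp
  rw [if_neg hT]
  set q := p.toReal with hqdef
  have hpi := Real.pi_pos
  have hr0 : 0 < r := by linarith
  have hq0 : q ≠ 0 := by linarith
  set G : ℝ → ℝ := fun t => ‖f (r * Complex.exp (t * Complex.I))‖ with hG
  have hGc : Continuous G := by fun_prop
  have hG0 : ∀ t, 0 ≤ G t := fun t => norm_nonneg _
  have hGX : ∀ t, G t ≤ X := fun t => h _ (by
    simp [Complex.norm_exp_ofReal_mul_I, abs_of_nonneg hr0.le])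
  have hGq : IntervalIntegrable (fun t => G t ^ q) MeasureTheory.volume 0 (2*Real.pi) :=
    (hGc.rpow_const (fun _ => Or.inr (by linarith))).intervalIntegrable _ _
  have hG2 : IntervalIntegrable (fun t => G t ^ 2) MeasureTheory.volume 0 (2*Real.pi) :=
    (hGc.pow 2).intervalIntegrable _ _
  have h0 : 0 ≤ ∫ t in (0:ℝ)..(2 * Real.pi), G t ^ q :=
      intervalIntegral.integral_nonneg (by positivity)
        (fun t _ => Real.rpow_nonneg (hG0 t) _)
  change ((1 / (2 * Real.pi)) * ∫ t in (0:ℝ)..(2 * Real.pi), G t ^ q) ^ (1/q) ≤ _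
  change ∫ t in (0:ℝ)..(2 * Real.pi), G t ^ 2 ≤ _ at h2
  rcases le_total 2 q with hq2 | hq2
  · rw [max_eq_right hq2]
    have hle : ∫ t in (0:ℝ)..(2 * Real.pi), G t ^ q
        ≤ ∫ t in (0:ℝ)..(2 * Real.pi), X ^ (q-2) * G t ^ 2 := by
      refine intervalIntegral.integral_mono_on (by positivity) hGq (hG2.const_mul _) ?_
      intro t _
      have : G t ^ q = G t ^ (q-2) * G t ^ 2 := by
        rw [← Real.rpow_natCast, ← Real.rpow_add_of_nonneg (hG0 t) (by linarith) (by norm_num)]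
        congr 1; norm_num
      rw [this]
      gcongr
      exact hGX t
    rw [intervalIntegral.integral_const_mul] at hle
    have hle2 : (1 / (2 * Real.pi)) * ∫ t in (0:ℝ)..(2 * Real.pi), G t ^ q
        ≤ X ^ q * r^(-(1/2) : ℝ) := by
      have e : X ^ q = X ^ (q-2) * X ^ 2 := by
        rw [← Real.rpow_natCast, ← Real.rpow_add hX]
        congr 1; norm_num
      calc _ ≤ (1 / (2 * Real.pi)) * (X ^ (q-2) * (2 * Real.pi * (X^2 * r^(-(1/2) : ℝ)))) := by
            gcongr; exact hle.trans (by gcongr)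
        _ = _ := by rw [e]; field_simp
    calc _ ≤ (X ^ q * r^(-(1/2) : ℝ)) ^ (1/q) := by gcongr
      _ = X * r ^ (-(1/(2*q))) := by
        rw [Real.mul_rpow (by positivity) (by positivity), one_div, Real.rpow_rpow_inv hX.le hq0,
          ← Real.rpow_mul hr0.le]
        congr 2; field_simp
      _ ≤ _ := by
        have : 0 ≤ X * r ^ (-(1/(2*q))) := by positivity
        linarith
  · rw [max_eq_left hq2]
    set Q := X * r ^ (-(1/(2*2)) : ℝ) with hQ
    have hQ0 : 0 < Q := by positivity
    have hQ2 : Q^2 = X^2 * r^(-(1/2) : ℝ) := by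
      rw [hQ, mul_pow, ← Real.rpow_natCast (r ^ _), ← Real.rpow_mul hr0.le]
      norm_num
    rw [← hQ2] at h2
    have hle : ∫ t in (0:ℝ)..(2 * Real.pi), G t ^ q
        ≤ ∫ t in (0:ℝ)..(2 * Real.pi), (Q^q + Q^q / Q^2 * G t ^ 2) := by
      refine intervalIntegral.integral_mono_on (by positivity) hGq
        (intervalIntegrable_const.add (hG2.const_mul _)) ?_
      intro t _
      have hx0 : 0 ≤ G t / Q := div_nonneg (hG0 t) hQ0.le
      have e : G t = Q * (G t / Q) := by field_simp
      have : (G t / Q)^q ≤ 1 + (G t / Q)^2 := by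
        rcases le_total (G t / Q) 1 with h | h
        · exact (Real.rpow_le_one hx0 h (by linarith)).trans (by nlinarith)
        · calc (G t / Q)^q ≤ (G t / Q)^(2:ℝ) := Real.rpow_le_rpow_of_exponent_le h hq2
            _ ≤ _ := by rw [Real.rpow_two]; linarith
      calc G t ^ q = Q^q * (G t / Q)^q := by
            conv_lhs => rw [e]
            rw [Real.mul_rpow hQ0.le hx0]
        _ ≤ Q^q * (1 + (G t / Q)^2) := by gcongr
        _ = _ := by rw [div_pow]; ring
    rw [intervalIntegral.integral_add intervalIntegrable_const (hG2.const_mul _),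
      intervalIntegral.integral_const_mul, intervalIntegral.integral_const, sub_zero,
      smul_eq_mul] at hle
    have hle2 : (1 / (2 * Real.pi)) * ∫ t in (0:ℝ)..(2 * Real.pi), G t ^ q ≤ 2 * Q^q := by
      calc _ ≤ (1 / (2 * Real.pi)) * (2 * Real.pi * Q^q + Q^q / Q^2 * (2 * Real.pi * Q^2)) := by
            gcongr; exact hle.trans (by gcongr)
        _ = _ := by field_simp; ring
    calc _ ≤ (2 * Q^q) ^ (1/q) := by gcongr
      _ = 2^(1/q) * Q := by
        rw [Real.mul_rpow (by norm_num) (by positivity), one_div q, Real.rpow_rpow_inv hQ0.le hq0]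
      _ ≤ 2^(1:ℝ) * Q := by
        gcongr
        · norm_num
        · rw [div_le_one (by linarith)]; exact hq
      _ = _ := by rw [Real.rpow_one, hQ]; ring

/-- Blocks where the coefficients are nonzero. -/
def setB : Set ℕ := {n | ∃ j : ℕ, (2*j).factorial < n ∧ n ≤ (2*j+1).factorial}

/-- Blocks where the coefficients vanish, far from the end. -/
def setA : Set ℕ := {n | ∃ j : ℕ, (2*j+1).factorial < n ∧ 2 * n ≤ (2*j+2).factorial}

lemma densB : upperDensity setB = 1 := by
  refine upperDensity_one (fun j => (2*j).factorial) (fun j => (j+1) * (2*j).factorial)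
    (fun j => Nat.factorial_pos _) (fun j => rfl) (fun j n h1 h2 => ⟨j, h1, h2.trans ?_⟩)
    (fun j => by have := Nat.self_le_factorial (2*j); omega)
  rw [Nat.factorial_succ]
  exact Nat.mul_le_mul_right _ (by omega)

lemma densA : upperDensity setA = 1 := by
  refine upperDensity_one (fun j => (2*j+1).factorial) (fun j => (j+1) * (2*j+1).factorial)
    (fun j => Nat.factorial_pos _) (fun j => rfl) (fun j n h1 h2 => ⟨j, h1, ?_⟩)
    (fun j => by have := Nat.self_le_factorial (2*j+1); omega)
  rw [Nat.factorial_succ (2*j+1)]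
  nlinarith

lemma AB_gap {n k : ℕ} (hn : n ∈ setA) (h1 : n ≤ k) (h2 : k < 2 * n) : k ∉ setB := by
  obtain ⟨j, hj1, hj2⟩ := hn
  rintro ⟨i, hi1, hi2⟩
  have a1 : (2*i).factorial < (2*j+2).factorial := by omega
  have a2 : (2*j+1).factorial < (2*i+1).factorial := by omega
  have b1 : 2*i < 2*j+2 := by
    by_contra hh
    exact absurd (Nat.factorial_le (not_lt.1 hh)) (not_le.2 a1)
  have b2 : 2*j+1 < 2*i+1 := by
    by_contra hh
    exact absurd (Nat.factorial_le (not_lt.1 hh)) (not_le.2 a2)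
  omega

open scoped Classical in
/-- The coefficients. -/
noncomputable def cf (δ : ℝ) (k₀ : ℕ) (n : ℕ) : ℝ :=
  if n ∈ setB ∧ k₀ ≤ n then ((n:ℝ)+1)^δ else 0

lemma cf_nonneg (δ : ℝ) (k₀ n : ℕ) : 0 ≤ cf δ k₀ n := by
  unfold cf; split_ifs <;> positivity

lemma cf_le (δ : ℝ) (k₀ n : ℕ) : cf δ k₀ n ≤ ((n:ℝ)+1)^δ := by
  unfold cf
  split_ifs
  · exact le_rfl
  · positivity

lemma cf_abs {δ : ℝ} (hδ : δ ≤ 1) (k₀ n : ℕ) : |cf δ k₀ n| ≤ 1 * ((n:ℝ)+1) := by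
  rw [abs_of_nonneg (cf_nonneg _ _ _), one_mul]
  refine (cf_le _ _ _).trans ?_
  calc ((n:ℝ)+1)^δ ≤ ((n:ℝ)+1)^(1:ℝ) :=
        Real.rpow_le_rpow_of_exponent_le (by linarith [(n.cast_nonneg : (0:ℝ) ≤ n)]) hδ
    _ = _ := Real.rpow_one _

open Nat in
lemma tend_A {δ : ℝ} (hδ : δ ≤ 1) (k₀ m : ℕ) :
    Tendsto (fun n : ℕ => supD (iteratedDeriv n (FF (cf δ k₀))) m)
          (atTop ⊓ 𝓟 setA) (nhds 0) := by
  have hb := cf_abs hδ k₀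
  have hs := summ_basic m
  have htail := tendsto_sum_nat_add (fun n : ℕ => ((n:ℝ)+1)^2 * |(m:ℝ)|^n / n !)
  refine tendsto_of_tendsto_of_tendsto_of_le_of_le' tendsto_const_nhds
    (htail.mono_left inf_le_left) ?_ ?_
  · refine Eventually.of_forall fun n => ?_
    refine (norm_nonneg _).trans (supD_ge ?_ m.cast_nonneg)
    rw [FF_iter hb]
    exact (FF_differentiable (shift_bound hb n)).continuous
  · rw [eventually_inf_principal]
    refine Eventually.of_forall fun n hn => ?_
    rw [FF_iter hb]
    refine supD_le m.cast_nonneg fun z hz => ?_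
    refine (FF_norm_le (shift_bound hb n) hz).trans ?_
    have hs1 := FF_summable (shift_bound hb n) m
    rw [abs_of_nonneg (m.cast_nonneg)] at hs1
    rw [← hs1.sum_add_tsum_nat_add n, Finset.sum_eq_zero, zero_add]
    · refine ((summable_nat_add_iff n).2 hs1).tsum_le_tsum (fun k => ?_)
        ((summable_nat_add_iff n).2 hs)
      rw [abs_of_nonneg (m.cast_nonneg : (0:ℝ) ≤ m)]
      gcongr
      refine (hb _).trans ?_
      push_cast
      nlinarith [(n.cast_nonneg : (0:ℝ) ≤ n), (k.cast_nonneg : (0:ℝ) ≤ k), mul_nonneg (n.cast_nonneg : (0:ℝ) ≤ n) (k.cast_nonneg : (0:ℝ) ≤ k), sq_nonneg ((k:ℝ)+n)]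
    · intro k hk
      rw [Finset.mem_range] at hk
      have : k + n ∉ setB := AB_gap hn (by omega) (by omega)
      simp [cf, this]

lemma tend_B {δ : ℝ} (hδ0 : 0 < δ) (hδ : δ ≤ 1) (k₀ m : ℕ) :
    Tendsto (fun n : ℕ => supD (iteratedDeriv n (FF (cf δ k₀))) m)
          (atTop ⊓ 𝓟 setB) atTop := by
  have hb := cf_abs hδ k₀
  have ht : Tendsto (fun n : ℕ => ((n:ℝ)+1)^δ) atTop atTop :=
    (tendsto_rpow_atTop hδ0).comp (tendsto_atTop_add_const_right _ _ tendsto_natCast_atTop_atTop)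
  refine tendsto_atTop_mono' _ ?_ (ht.mono_left inf_le_left)
  rw [EventuallyLE, eventually_inf_principal]
  filter_upwards [eventually_ge_atTop k₀] with n hk hn
  have h := supD_ge (FF_differentiable (shift_bound hb n)).continuous (m.cast_nonneg : (0:ℝ) ≤ m)
  rw [FF_iter hb]
  refine le_trans ?_ h
  rw [FF_zero, Complex.norm_real, Real.norm_eq_abs, zero_add]
  refine le_trans ?_ (le_abs_self _)
  simp [cf, hn, hk]

open Nat in
lemma FF_big {δ : ℝ} (hδ0 : 0 < δ) (hδ : δ ≤ 1/2) (k₀ : ℕ) {r : ℝ} (hr : 1 ≤ r) :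
    (∀ z : ℂ, ‖z‖ = r → ‖FF (cf δ k₀) z‖ ≤ 4 * r^δ * Real.exp r) ∧
    ∫ t in (0:ℝ)..(2 * Real.pi), ‖FF (cf δ k₀) (r * Complex.exp (t * Complex.I))‖ ^ 2
      ≤ 2 * Real.pi * ((4 * r^δ * Real.exp r)^2 * r^(-(1/2) : ℝ)) := by
  have hb := cf_abs (by linarith : δ ≤ 1) k₀
  have hr0 : 0 < r := by linarith
  constructor
  · intro z hz
    refine (FF_norm_le hb hz.le).trans ?_
    simp_rw [abs_of_nonneg (cf_nonneg δ k₀ _)]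
    exact (poisson_weight hr hδ0.le (by linarith) (cf_nonneg δ k₀) (cf_le δ k₀)).2
  · rw [FF_L2 hb]
    have hpi := Real.pi_pos
    refine mul_le_mul_of_nonneg_left ?_ (by positivity)
    obtain ⟨hs, hle⟩ := poisson_weight (r := r) (η := 2*δ) (d := fun n => (cf δ k₀ n)^2) hr
      (by linarith) (by linarith) (fun n => sq_nonneg _) (fun n => by
        rw [mul_comm, Real.rpow_mul (by positivity), Real.rpow_two]
        have := cf_nonneg δ k₀ n
        have := cf_le δ k₀ n
        gcongr)
    have hterm : ∀ n : ℕ, (cf δ k₀ n * r^n / n !)^2 ≤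
        Real.exp r / √r * ((cf δ k₀ n)^2 * r^n / n !) := fun n => by
      have := poisson_max hr n
      calc (cf δ k₀ n * r^n / n !)^2 = (r^n / n !) * ((cf δ k₀ n)^2 * r^n / n !) := by ring
        _ ≤ _ := by gcongr
    have hs' := hs.mul_left (Real.exp r / √r)
    have hs2 : Summable (fun n : ℕ => (cf δ k₀ n * r^n / n !)^2) :=
      Summable.of_nonneg_of_le (fun n => sq_nonneg _) hterm hs'
    refine (hs2.tsum_le_tsum hterm hs').trans ?_
    rw [tsum_mul_left]
    have e1 : r^(-(1/2) : ℝ) = 1 / √r := by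
      rw [Real.rpow_neg hr0.le, ← Real.sqrt_eq_rpow, one_div]
    have e2 : r^(2*δ) = (r^δ)^2 := by
      rw [mul_comm, Real.rpow_mul hr0.le, Real.rpow_two]
    rw [e1]
    rw [e2] at hle
    calc _ ≤ Real.exp r / √r * (4 * (r^δ)^2 * Real.exp r) := by gcongr
      _ = 4 * ((r^δ)^2 * (Real.exp r)^2 * (1/√r)) := by ring
      _ ≤ 16 * ((r^δ)^2 * (Real.exp r)^2 * (1/√r)) := by gcongr; norm_num
      _ = _ := by ring

open Nat in
lemma FF_small {δ : ℝ} (hδ0 : 0 < δ) (hδ : δ ≤ 1/2) (k₀ : ℕ) {r : ℝ} (hr0 : 0 < r) (hr : r ≤ 1) :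
    ∀ z : ℂ, ‖z‖ = r → ‖FF (cf δ k₀) z‖ ≤ 4 * Real.exp 1 * r^k₀ := by
  have hb := cf_abs (by linarith : δ ≤ 1) k₀
  intro z hz
  refine (FF_norm_le hb hz.le).trans ?_
  simp_rw [abs_of_nonneg (cf_nonneg δ k₀ _)]
  obtain ⟨hs, hle⟩ := poisson_weight (r := 1) le_rfl hδ0.le (by linarith) (cf_nonneg δ k₀) (cf_le δ k₀)
  have hterm : ∀ n : ℕ, cf δ k₀ n * r^n / n ! ≤ r^k₀ * (cf δ k₀ n * 1^n / n !) := fun n => by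
    by_cases h : k₀ ≤ n
    · have : r^n ≤ r^k₀ := pow_le_pow_of_le_one hr0.le hr h
      have := cf_nonneg δ k₀ n
      calc cf δ k₀ n * r^n / n ! ≤ cf δ k₀ n * r^k₀ / n ! := by gcongr
        _ = _ := by rw [one_pow]; ring
    · simp [cf, h]
  have hs2 := FF_summable hb r
  simp_rw [abs_of_nonneg (cf_nonneg δ k₀ _), abs_of_nonneg hr0.le] at hs2
  refine (hs2.tsum_le_tsum hterm (hs.mul_left _)).trans ?_
  rw [tsum_mul_left, mul_comm]
  gcongr
  simpa using hle

theorem stmt9 (p : ENNReal) (hp : 1 ≤ p) (a : ℝ)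
    (ha : a = if p = ⊤ then 0 else 1 / (2 * max 2 p.toReal))
    (ε : ℝ) (hε : 0 < ε) :
    ∃ f : ℂ → ℂ, Differentiable ℂ f ∧
      (∃ C : ℝ, 0 < C ∧ ∀ r : ℝ, 0 < r → Mp p f r ≤ C * Real.exp r / r ^ (a - ε)) ∧
      ∃ A B : Set ℕ, upperDensity A = 1 ∧ upperDensity B = 1 ∧
        (∀ m : ℕ, Tendsto (fun n : ℕ => supD (iteratedDeriv n f) m)
          (atTop ⊓ 𝓟 A) (nhds 0)) ∧
        (∀ m : ℕ, Tendsto (fun n : ℕ => supD (iteratedDeriv n f) m)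
          (atTop ⊓ 𝓟 B) atTop) := by
  obtain ⟨k₀, hk₀⟩ := exists_nat_ge ε
  set δ := min ε (1/2) with hδdef
  have hδ0 : 0 < δ := lt_min hε (by norm_num)
  have hδε : δ ≤ ε := min_le_left _ _
  have hδ : δ ≤ 1/2 := min_le_right _ _
  have hδ1 : δ ≤ 1 := by linarith
  have hdiff := FF_differentiable (cf_abs hδ1 k₀)
  refine ⟨FF (cf δ k₀), hdiff, ⟨8 * Real.exp 1, by positivity, fun r hr0 => ?_⟩,
    setA, setB, densA, densB, tend_A hδ1 k₀, tend_B hδ0 hδ1 k₀⟩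
  have ha0 : 0 ≤ a := by
    rw [ha]; split_ifs <;> positivity
  have e1 : (1:ℝ) ≤ Real.exp 1 := Real.one_le_exp (by norm_num)
  have hdiv : 8 * Real.exp 1 * Real.exp r / r ^ (a - ε) = 8 * Real.exp 1 * Real.exp r * r^(ε - a) := by
    rw [div_eq_mul_inv, ← Real.rpow_neg hr0.le, neg_sub]
  rw [hdiv]
  rcases le_total r 1 with hr | hr
  · refine (Mp_le_sup hp hdiff.continuous hr0.le (FF_small hδ0 hδ k₀ hr0 hr)).trans ?_
    have h1 : r^k₀ ≤ r^(ε - a) := by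
      rw [← Real.rpow_natCast]
      exact Real.rpow_le_rpow_of_exponent_ge hr0 hr (by linarith)
    have h2 : (1:ℝ) ≤ Real.exp r := Real.one_le_exp hr0.le
    calc 4 * Real.exp 1 * r^k₀ ≤ 8 * Real.exp 1 * r^(ε - a) := by gcongr; norm_num
      _ = 8 * Real.exp 1 * 1 * r^(ε - a) := by ring
      _ ≤ _ := by gcongr
  · obtain ⟨b1, b2⟩ := FF_big hδ0 hδ k₀ hr
    have key : Mp p (FF (cf δ k₀)) r ≤ 2 * (4 * r^δ * Real.exp r) * r^(-a) := by
      by_cases hT : p = ⊤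
      · rw [if_pos hT] at ha
        rw [ha, neg_zero, Real.rpow_zero, mul_one]
        refine (Mp_le_sup hp hdiff.continuous hr0.le b1).trans ?_
        have : 0 ≤ 4 * r^δ * Real.exp r := by positivity
        linarith
      · rw [if_neg hT] at ha
        rw [ha]
        exact Mp_fin hp hT hdiff.continuous hr (by positivity) b1 b2
    refine key.trans ?_
    have h1 : r^δ * r^(-a) ≤ r^(ε - a) := by
      rw [← Real.rpow_add hr0]
      exact Real.rpow_le_rpow_of_exponent_le hr (by linarith)
    calc 2 * (4 * r^δ * Real.exp r) * r^(-a) = 8 * 1 * Real.exp r * (r^δ * r^(-a)) := by ring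
      _ ≤ _ := by gcongr
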